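/- Let q be a prime power with q ≡ 3 (mod 4), r ≥ 3 an integer with r ≡ 3 (mod 4), a ∈ F\{0} and b ∈ F with b^q ≠ b, where F = GF(q²), and suppose 4a^{q+1} + (b^q − b)² = 0. Then B(a,b) has exactly q^{2r−1} points and for every affine hyperplane π of F^r the cardinality |π ∩ B(a,b)| belongs to the set { q^{2r−3} + q^{(3r−5)/2} − q^{3(r−1)/2}, q^{2r−3}, q^{2r−3} + q^{(3r−5)/2} }. -/

import Mathlib

open Finset

/-- The affine point set `B(a,b) ⊆ AG(r,q²)`: a point of `F^r` is encoded as a pair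
consisting of its first `r - 1` coordinates `(x₁, …, x_{r-1})` together with its last
coordinate `x_r`.  It consists of the solutions of
`x_r^q − x_r + a^q(x₁^{2q}+⋯+x_{r−1}^{2q}) − a(x₁²+⋯+x_{r−1}²)
  = (b^q − b)(x₁^{q+1}+⋯+x_{r−1}^{q+1})`. -/
def BSet (q r : ℕ) {F : Type*} [Field F] (a b : F) :
    Set ((Fin (r - 1) → F) × F) :=
  {x | x.2 ^ q - x.2 + a ^ q * (∑ i, x.1 i ^ (2 * q)) - a * (∑ i, x.1 i ^ 2)
      = (b ^ q - b) * ∑ i, x.1 i ^ (q + 1)}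


section gen
variable {K : Type*} [Field K] [Fintype K] [DecidableEq K]

lemma card_hyper (n : ℕ) (c : Fin n → K) (hc : c ≠ 0) (d : K) :
    Fintype.card {x : Fin n → K // ∑ i, c i * x i = d} = Fintype.card K ^ (n - 1) := by
  obtain ⟨i, hi⟩ := Function.ne_iff.mp hc
  let f : (Fin n → K) →+ K :=
    { toFun := fun x => ∑ i, c i * x i
      map_zero' := by simp
      map_add' := by intro x y; simp [mul_add, Finset.sum_add_distrib] }
  have hs : Function.Surjective f := by
    intro y
    refine ⟨Pi.single i (y / c i), ?_⟩
    change ∑ j, c j * (Pi.single i (y / c i) : Fin n → K) j = y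
    rw [Finset.sum_eq_single i]
    · simp at hi ⊢; field_simp
    · intro j _ hj; simp [hj]
    · simp
  have h1 : ∀ e : K, #{x | f x = e} = #{x | f x = d} := fun e =>
    AddMonoidHom.card_fiber_eq_of_mem_range f (hs e) (hs d)
  have h2 := Finset.card_eq_sum_card_fiberwise (f := f) (s := univ) (t := univ) (by simp)
  simp only [h1, sum_const, card_univ, smul_eq_mul, Fintype.card_pi, prod_const, Fintype.card_fin] at h2
  have hn : n = (n - 1) + 1 := by have := i.pos; omega
  rw [Fintype.card_subtype]
  have h3 : Fintype.card K * #{x | f x = d} = Fintype.card K * Fintype.card K ^ (n - 1) := by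
    rw [← h2, ← pow_succ', ← hn]
  exact Nat.eq_of_mul_eq_mul_left Fintype.card_pos h3

lemma sq_add_sq_zero (hq : Fintype.card K % 4 = 3) (x y : K) (h : x ^ 2 + y ^ 2 = 0) :
    x = 0 ∧ y = 0 := by
  have hns : ¬ IsSquare (-1 : K) := by
    rw [FiniteField.isSquare_neg_one_iff]; omega
  by_cases hy : y = 0
  · subst hy; simp at h; exact ⟨h, rfl⟩
  · exact absurd ⟨x / y, by field_simp; linear_combination -h⟩ hns

lemma card_two (hq : Fintype.card K % 4 = 3) (f : K) :
    (#{p : K × K | p.1 ^ 2 + p.2 ^ 2 = f} : ℤ)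
      = (Fintype.card K + 1) - if f = 0 then (Fintype.card K : ℤ) else 0 := by
  have h0 : #{p : K × K | p.1 ^ 2 + p.2 ^ 2 = 0} = 1 := by
    rw [Finset.card_eq_one]
    refine ⟨(0, 0), ?_⟩
    ext ⟨x, y⟩
    simp only [mem_filter, mem_univ, true_and, mem_singleton, Prod.mk.injEq]
    exact ⟨sq_add_sq_zero hq x y, by rintro ⟨rfl, rfl⟩; simp⟩
  have h1 : ∀ e : K, e ≠ 0 → #{p : K × K | p.1 ^ 2 + p.2 ^ 2 = e}
      = #{p : K × K | p.1 ^ 2 + p.2 ^ 2 = 1} := by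
    intro e he
    obtain ⟨α, β, hab⟩ : ∃ α β : K, α ^ 2 + β ^ 2 = e := by
      obtain ⟨x, y, h⟩ := FiniteField.exists_root_sum_quadratic (R := K)
        (f := Polynomial.X ^ 2) (g := Polynomial.X ^ 2 - Polynomial.C e)
        (by simp) (by rw [Polynomial.degree_X_pow_sub_C] <;> simp) (by omega)
      refine ⟨x, y, ?_⟩
      simp at h; linear_combination h
    symm
    apply Finset.card_bij' (fun p _ => (α * p.1 - β * p.2, α * p.2 + β * p.1))
      (fun p _ => ((α * p.1 + β * p.2) / e, (α * p.2 - β * p.1) / e))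
    · rintro ⟨x, y⟩ h
      simp only [mem_filter, mem_univ, true_and] at h ⊢
      linear_combination (α ^ 2 + β ^ 2) * h + hab
    · rintro ⟨x, y⟩ h
      simp only [mem_filter, mem_univ, true_and] at h ⊢
      field_simp
      linear_combination (α ^ 2 + β ^ 2) * h + e * hab
    · rintro ⟨x, y⟩ h
      ext <;> simp only <;> field_simp
      · linear_combination x * hab
      · linear_combination y * hab
    · rintro ⟨x, y⟩ h
      ext <;> simp only <;> field_simp
      · linear_combination x * hab
      · linear_combination y * hab
  have h2 := Finset.card_eq_sum_card_fiberwise (f := fun p : K × K => p.1 ^ 2 + p.2 ^ 2)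
    (s := univ) (t := univ) (by simp)
  rw [← Finset.add_sum_erase _ _ (mem_univ (0 : K)), h0,
    Finset.sum_congr rfl (fun e he => h1 e (ne_of_mem_erase he))] at h2
  simp only [sum_const, card_erase_of_mem (mem_univ _), card_univ, smul_eq_mul,
    Fintype.card_prod] at h2
  obtain ⟨k, hk⟩ : ∃ k, Fintype.card K = k + 3 := ⟨Fintype.card K - 3, by omega⟩
  have h3 : #{p : K × K | p.1 ^ 2 + p.2 ^ 2 = 1} = Fintype.card K + 1 := by
    rw [hk] at h2 ⊢
    have : (k + 2) * #{p : K × K | p.1 ^ 2 + p.2 ^ 2 = 1} = (k + 2) * (k + 3 + 1) := by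
      have e1 : k + 3 - 1 = k + 2 := by omega
      rw [e1] at h2; linarith
    exact Nat.eq_of_mul_eq_mul_left (by omega) this
  split_ifs with hf
  · rw [hf, h0]; simp
  · rw [h1 f hf, h3]; simp

lemma sum_two (hq : Fintype.card K % 4 = 3) (g : K → ℤ) :
    ∑ x : K, ∑ y : K, g (x ^ 2 + y ^ 2)
      = (Fintype.card K + 1) * ∑ f, g f - Fintype.card K * g 0 := by
  rw [← Fintype.sum_prod_type' (f := fun x y => g (x ^ 2 + y ^ 2)),
    ← Finset.sum_fiberwise (s := univ) (g := fun p : K × K => p.1 ^ 2 + p.2 ^ 2)]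
  have : ∀ j : K, ∑ i ∈ univ with (i : K × K).1 ^ 2 + i.2 ^ 2 = j, g (i.1 ^ 2 + i.2 ^ 2)
      = ((Fintype.card K + 1) - if j = 0 then (Fintype.card K : ℤ) else 0) * g j := by
    intro j
    rw [← card_two hq j, Finset.sum_congr rfl (g := fun _ => g j)]
    · simp
    · intro p hp; simp at hp; rw [hp]
  rw [Finset.sum_congr rfl (fun j _ => this j)]
  simp [sub_mul, Finset.sum_sub_distrib, Finset.mul_sum]

lemma sum_fin_cons (n : ℕ) (g : (Fin (n + 1) → K) → ℤ) :
    ∑ w, g w = ∑ x : K, ∑ v : Fin n → K, g (Fin.cons x v) := by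
  rw [← Fintype.sum_prod_type' (f := fun x v => g (Fin.cons x v))]
  exact (Fintype.sum_equiv (Fin.consEquiv (fun _ => K)) _ _ (fun _ => rfl)).symm

lemma count_sq (hq : Fintype.card K % 4 = 3) (m : ℕ) : ∀ e : K,
    (Fintype.card K : ℤ) * ∑ w : Fin (2 * m) → K, (if ∑ i, w i ^ 2 = e then 1 else 0)
      = Fintype.card K ^ (2 * m) + (-Fintype.card K : ℤ) ^ m *
        ((Fintype.card K : ℤ) * (if e = 0 then 1 else 0) - 1) := by
  induction m with
  | zero => intro e; simp [eq_comm]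
  | succ m ih =>
    intro e
    have e0 : ∑ w : Fin (2 * (m + 1)) → K, (if ∑ i, w i ^ 2 = e then (1 : ℤ) else 0)
        = ∑ x : K, ∑ y : K, ∑ u : Fin (2 * m) → K,
          if x ^ 2 + (y ^ 2 + ∑ i, u i ^ 2) = e then (1 : ℤ) else 0 := by
      refine (sum_fin_cons (2 * m + 1) _).trans ?_
      refine Finset.sum_congr rfl fun x _ => ?_
      refine (sum_fin_cons (2 * m) _).trans ?_
      refine Finset.sum_congr rfl fun y _ => ?_
      refine Finset.sum_congr rfl fun u _ => ?_
      have : ∑ i : Fin (2 * m + 1 + 1),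
          (Fin.cons x (Fin.cons y u : Fin (2 * m + 1) → K) : Fin (2 * m + 1 + 1) → K) i ^ 2
          = x ^ 2 + (y ^ 2 + ∑ i, u i ^ 2) := by
        rw [Fin.sum_univ_succ, Fin.sum_univ_succ]
        simp only [Fin.cons_zero, Fin.cons_succ]
      rw [← this]; rfl
    rw [e0]
    have hg := sum_two hq (fun f => ∑ w : Fin (2 * m) → K, (if ∑ i, w i ^ 2 = e - f then (1:ℤ) else 0))
    have e1 : ∀ x y : K, ∀ w : Fin (2 * m) → K,
      (x ^ 2 + (y ^ 2 + ∑ i, w i ^ 2) = e) = (∑ i, w i ^ 2 = e - (x ^ 2 + y ^ 2)) := by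
      intro x y w; apply propext
      constructor <;> intro h <;> linear_combination h
    simp_rw [e1]
    rw [hg]
    have e2 : ∑ f, ∑ w : Fin (2 * m) → K, (if ∑ i, w i ^ 2 = e - f then (1:ℤ) else 0)
        = Fintype.card K ^ (2 * m) := by
      rw [Finset.sum_comm]
      have : ∀ w : Fin (2 * m) → K, ∑ f, (if ∑ i, w i ^ 2 = e - f then (1:ℤ) else 0) = 1 := by
        intro w
        rw [Finset.sum_eq_single (e - ∑ i, w i ^ 2)]
        · simp
        · intro f _ hf; rw [if_neg]; intro h; apply hf; rw [h]; ring
        · simp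
      simp [this]
    rw [e2, sub_zero, mul_sub, mul_left_comm _ _ (Finset.sum _ _), ih e]
    ring

lemma count_quad (hq : Fintype.card K % 4 = 3) (m : ℕ) (hm : m % 2 = 1) (k d : K) (hk : k ≠ 0)
    (c : Fin (2 * m) → K) :
    let N := Fintype.card {w : Fin (2 * m) → K // k * ∑ i, w i ^ 2 - ∑ i, c i * w i + d = 0}
    N + Fintype.card K ^ m =
      Fintype.card K ^ (2 * m - 1) + Fintype.card K ^ (m - 1) ∨
    N = Fintype.card K ^ (2 * m - 1) + Fintype.card K ^ (m - 1) := by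
  intro N
  have h2 : (2 : K) ≠ 0 := by
    apply Ring.two_ne_zero
    intro h
    have := FiniteField.even_card_of_char_two h; omega
  set e : K := ∑ i, (c i / (2 * k)) ^ 2 - d / k with he
  have hN : (N : ℤ) = ∑ w : Fin (2 * m) → K, (if ∑ i, w i ^ 2 = e then 1 else 0) := by
    simp only [N]
    rw [Fintype.card_subtype, Finset.card_filter]
    push_cast
    apply Fintype.sum_equiv (Equiv.subRight (fun i => c i / (2 * k)))
    intro w
    have : (k * ∑ i, w i ^ 2 - ∑ i, c i * w i + d = 0) ↔
       ∑ i, ((Equiv.subRight (fun i => c i / (2 * k))) w i) ^ 2 = e := by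
      have e1 : ∑ i, ((Equiv.subRight (fun i => c i / (2 * k))) w i) ^ 2 - e
        = (k * ∑ i, w i ^ 2 - ∑ i, c i * w i + d) / k := by
        have : ∀ i, ((Equiv.subRight (fun i => c i / (2 * k))) w i) ^ 2
          = w i ^ 2 - (c i * w i) / k + (c i / (2 * k)) ^ 2 := by
          intro i; simp; field_simp; ring
        simp_rw [this, Finset.sum_add_distrib, Finset.sum_sub_distrib, he, ← Finset.sum_div]
        field_simp; ring
      rw [← sub_eq_zero (b := e), e1, div_eq_zero_iff]
      simp [hk]
    simp only [this]
  have h := count_sq hq m e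
  rw [← hN] at h
  obtain ⟨j, rfl⟩ : ∃ j, m = 2 * j + 1 := ⟨m / 2, by omega⟩
  have hp : (Fintype.card K : ℤ) ≠ 0 := by exact_mod_cast Fintype.card_ne_zero
  have hodd : (-Fintype.card K : ℤ) ^ (2 * j + 1) = - Fintype.card K ^ (2 * j + 1) :=
    Odd.neg_pow ⟨j, rfl⟩ _
  rw [hodd] at h
  have i1 : 2 * (2 * j + 1) - 1 = 4 * j + 1 := by omega
  have i2 : 2 * j + 1 - 1 = 2 * j := by omega
  rw [i1, i2]
  split_ifs at h with h0
  · left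
    zify
    apply mul_left_cancel₀ hp
    linear_combination h
  · right
    zify
    apply mul_left_cancel₀ hp
    linear_combination h
end gen

section core
variable {F : Type*} [Field F] [Fintype F]

/-- fixed field -/
abbrev fixK (σ : F →+* F) : Subfield F := σ.eqLocusField (RingHom.id F)

lemma mem_fixK (σ : F →+* F) (x : F) : x ∈ fixK σ ↔ σ x = x := Iff.rfl

lemma coord_bij (σ : F →+* F) (hσ : ∀ x, σ (σ x) = x) (h2 : (2 : F) ≠ 0) (β : F) (hβ0 : β ≠ 0)
    (hβ : σ β = -β) :
    Function.Bijective (fun p : fixK σ × fixK σ => (p.1 : F) + β * p.2) := by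
  constructor
  · rintro ⟨⟨x, hx⟩, ⟨y, hy⟩⟩ ⟨⟨x', hx'⟩, ⟨y', hy'⟩⟩ h
    rw [mem_fixK] at hx hy hx' hy'
    simp only at h
    have h' := congrArg σ h
    simp only [map_add, map_mul, hx, hy, hx', hy', hβ] at h'
    have e1 : x = x' := by
      apply mul_left_cancel₀ h2; linear_combination h + h'
    have e2 : y = y' := by
      apply mul_left_cancel₀ (mul_ne_zero h2 hβ0); linear_combination h - h'
    simp [e1, e2]
  · intro x
    refine ⟨(⟨(x + σ x) / 2, ?_⟩, ⟨(x - σ x) / (2 * β), ?_⟩), ?_⟩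
    · rw [mem_fixK]; simp only [map_div₀, map_add, hσ, map_ofNat, add_comm]
    · rw [mem_fixK]; simp only [map_div₀, map_sub, map_mul, hσ, map_ofNat, hβ]; rw [mul_neg, ← neg_sub, neg_div_neg_eq]
    · simp only; field_simp; ring

lemma core (q n m : ℕ) (hq : q % 4 = 3) (hn : n = 2 * m) (hm : m % 2 = 1)
    (hF : Fintype.card F = q ^ 2)
    (σ : F →+* F) (hσ : ∀ x, σ (σ x) = x) (h2 : (2 : F) ≠ 0) (β : F) (hβ0 : β ≠ 0)
    (hβ : σ β = -β) (a s : F) (ha : a ≠ 0) (hs : s ≠ 0) (r1 : σ a * σ s ^ 2 = - (a * s ^ 2))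
    (r2 : β * s * σ s = 2 * (σ a * σ s ^ 2))
    (B : Set ((Fin n → F) × F))
    (hB : ∀ x, x ∈ B ↔ σ x.2 - x.2 + σ a * (∑ i, σ (x.1 i) ^ 2) - a * ∑ i, x.1 i ^ 2
      = β * ∑ i, x.1 i * σ (x.1 i)) :
    B.ncard = q ^ (2 * n + 1) ∧
    ∀ (c : Fin n → F) (c0 d : F), ¬(c = 0 ∧ c0 = 0) →
      let N := (({x : (Fin n → F) × F | (∑ i, c i * x.1 i) + c0 * x.2 = d} ∩ B)).ncard
      N + q ^ (3 * m) = q ^ (2 * n - 1) + q ^ (3 * m - 1) ∨ N = q ^ (2 * n - 1)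
        ∨ N = q ^ (2 * n - 1) + q ^ (3 * m - 1) := by
  classical
  have hbij := coord_bij σ hσ h2 β hβ0 hβ
  let E : fixK σ × fixK σ ≃ F := Equiv.ofBijective _ hbij
  have hE : ∀ p, E p = (p.1 : F) + β * p.2 := fun _ => rfl
  have hK : Fintype.card (fixK σ) = q := by
    have h := Fintype.card_congr E
    rw [Fintype.card_prod, hF, sq] at h
    exact Nat.mul_self_inj.mp h
  have hσK : ∀ k : fixK σ, σ (k : F) = k := fun k => k.2
  have hqpos : 0 < q := by omega
  let Hs : (Fin n → F) → F := fun x => (β * ∑ i, x i * σ (x i) - σ a * (∑ i, σ (x i) ^ 2)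
    + a * ∑ i, x i ^ 2) / 2
  have hHσ : ∀ x, σ (Hs x) = - Hs x := by
    intro x
    simp only [Hs, map_div₀, map_add, map_sub, map_mul, map_sum, map_pow, hσ, hβ, map_ofNat]
    have : ∑ i, σ (x i) * x i = ∑ i, x i * σ (x i) :=
      Finset.sum_congr rfl (fun i _ => mul_comm _ _)
    rw [this]; ring
  have hB' : ∀ x z, (x, z) ∈ B ↔ z + Hs x ∈ fixK σ := by
    intro x z
    rw [hB, mem_fixK, map_add, hHσ]
    have h2' : 2 * Hs x = β * ∑ i, x i * σ (x i) - σ a * (∑ i, σ (x i) ^ 2)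
        + a * ∑ i, x i ^ 2 := by simp only [Hs]; field_simp
    clear_value Hs
    constructor
    · intro h; linear_combination h - h2'
    · intro h; linear_combination h + h2'
  have key : ∀ P : (Fin n → F) → Prop, ({x : (Fin n → F) × F | P x.1} ∩ B).ncard
      = Nat.card {x // P x} * q := by
    intro P
    rw [← Nat.card_coe_set_eq, ← hK, ← Nat.card_eq_fintype_card, ← Nat.card_prod]
    refine Nat.card_congr ⟨fun y => (⟨y.1.1, y.2.1⟩, ⟨y.1.2 + Hs y.1.1, (hB' _ _).1 y.2.2⟩),
      fun y => ⟨(y.1.1, y.2.1 - Hs y.1.1), y.1.2, (hB' _ _).2 (by simp)⟩, ?_, ?_⟩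
    · rintro ⟨⟨x, z⟩, h⟩; simp
    · rintro ⟨⟨x, hx⟩, ⟨z, hz⟩⟩; simp
  constructor
  · have := key (fun _ => True)
    simp only [Set.ofPred_true, Set.univ_inter] at this
    rw [this, Nat.card_congr (Equiv.subtypeUnivEquiv (fun _ => trivial)), Nat.card_eq_fintype_card]
    simp [hF]; ring
  intro c c0 d hc N
  by_cases hc0 : c0 = 0
  · right; left
    simp only [N, hc0, zero_mul, add_zero]
    rw [key (fun x => ∑ i, c i * x i = d), Nat.card_eq_fintype_card,
      card_hyper n c (fun h => hc ⟨h, hc0⟩), hF, ← pow_mul, ← pow_succ]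
    congr 1; omega
  let c1 : Fin n → fixK σ := fun i => (E.symm (c i * s / c0)).1
  let c2 : Fin n → fixK σ := fun i => (E.symm (c i * s / c0)).2
  have hc12 : ∀ i, c i * s / c0 = (c1 i : F) + β * c2 i := fun i => by
    rw [← hE (c1 i, c2 i)]; simp [c1, c2]
  obtain ⟨⟨d1, d2⟩, hd⟩ := E.surjective (d / c0)
  rw [hE] at hd; simp only at hd
  have hκ : 2 * β * a * s ^ 2 ∈ fixK σ := by
    rw [mem_fixK]; simp only [map_mul, map_pow, map_ofNat, hβ]
    linear_combination (-2 * β) * r1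
  obtain ⟨k, hk⟩ : ∃ k : fixK σ, (k : F) = 2 * β * a * s ^ 2 := ⟨⟨_, hκ⟩, rfl⟩
  have hk0 : k ≠ 0 := by
    intro h; rw [h] at hk
    have : 2 * β * a * s ^ 2 ≠ 0 := by positivity
    exact this hk.symm
  let X : (Fin n → fixK σ) × (Fin n → fixK σ) ≃ (Fin n → F) :=
    ((Equiv.arrowProdEquivProdArrow (Fin n) (fun _ => fixK σ) (fun _ => fixK σ)).symm.trans
      (Equiv.piCongrRight (fun _ => E))).trans (Equiv.piCongrRight (fun _ => Equiv.mulLeft₀ s hs))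
  have hX : ∀ v w i, X (v, w) i = s * ((v i : F) + β * w i) := fun _ _ _ => rfl
  have hHX : ∀ v w, Hs (X (v, w)) = β * ((k * ∑ i, w i ^ 2 : fixK σ) : F) := by
    intro v w
    simp only [Hs, hX]
    push_cast
    rw [hk]
    simp only [Finset.mul_sum]
    rw [← Finset.sum_sub_distrib, ← Finset.sum_add_distrib, Finset.sum_div]
    apply Finset.sum_congr rfl
    intro i _
    simp only [map_mul, map_add, hβ, hσK]
    field_simp
    linear_combination ((v i : F) ^ 2 - β ^ 2 * (w i) ^ 2) * (r2 + 2 * r1)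
      - ((v i : F) - β * w i) ^ 2 * r1
  have hNX : N = Nat.card {p : (Fin n → fixK σ) × (Fin n → fixK σ) //
      k * ∑ i, p.2 i ^ 2 - ∑ i, c1 i * p.2 i - ∑ i, c2 i * p.1 i + d2 = 0} := by
    have e1 : N = Nat.card {x : Fin n → F // d / c0 - ∑ i, c i / c0 * x i + Hs x ∈ fixK σ} := by
      simp only [N]
      rw [← Nat.card_coe_set_eq]
      have hz : ∀ (x : Fin n → F) z, (∑ i, c i * x i) + c0 * z = d ↔
          z = d / c0 - ∑ i, c i / c0 * x i := by
        intro x z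
        have : ∑ i, c i / c0 * x i = (∑ i, c i * x i) / c0 := by
          rw [Finset.sum_div]; exact Finset.sum_congr rfl (fun i _ => by ring)
        rw [this]
        constructor
        · intro h; rw [← h]; field_simp; ring
        · rintro rfl; field_simp; ring
      refine Nat.card_congr ⟨fun y => ⟨y.1.1, ?_⟩,
        fun y => ⟨(y.1, d / c0 - ∑ i, c i / c0 * y.1 i), ?_, ?_⟩, ?_, ?_⟩
      · rw [← (hz y.1.1 y.1.2).1 y.2.1]; exact (hB' _ _).1 y.2.2
      · exact (hz _ _).2 rfl
      · exact (hB' _ _).2 y.2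
      · rintro ⟨⟨x, z⟩, h⟩
        have := (hz x z).1 h.1
        simp [← this]
      · rintro ⟨x, h⟩; rfl
    rw [e1]
    symm
    apply Nat.card_congr
    apply Equiv.subtypeEquiv X
    rintro ⟨v, w⟩
    have hβ2 : σ (β ^ 2) = β ^ 2 := by rw [map_pow, hβ]; ring
    have e2 : ∑ i, c i / c0 * X (v, w) i = ∑ i, ((c1 i * v i : F) + β ^ 2 * (c2 i * w i))
        + β * ((∑ i, c1 i * w i + ∑ i, c2 i * v i : fixK σ) : F) := by
      push_cast
      rw [← Finset.sum_add_distrib, Finset.mul_sum, ← Finset.sum_add_distrib]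
      apply Finset.sum_congr rfl
      intro i _
      rw [hX]
      linear_combination ((v i : F) + β * w i) * hc12 i
    rw [hHX, e2, ← hd]
    have hin : (d1 : F) - ∑ i, ((c1 i * v i : F) + β ^ 2 * (c2 i * w i)) ∈ fixK σ := by
      rw [mem_fixK]; simp only [map_sub, map_sum, map_add, map_mul, hσK, hβ2]
    obtain ⟨A, hA⟩ : ∃ A : fixK σ, (A : F)
      = (d1 : F) - ∑ i, ((c1 i * v i : F) + β ^ 2 * (c2 i * w i)) := ⟨⟨_, hin⟩, rfl⟩
    set T : fixK σ := k * ∑ i, w i ^ 2 - ∑ i, c1 i * w i - ∑ i, c2 i * v i + d2 with hT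
    have e3 : (d1 : F) + β * d2 - (∑ i, ((c1 i * v i : F) + β ^ 2 * (c2 i * w i))
        + β * ((∑ i, c1 i * w i + ∑ i, c2 i * v i : fixK σ) : F))
        + β * ((k * ∑ i, w i ^ 2 : fixK σ) : F) = A + β * T := by
      rw [hA, hT]; push_cast; ring
    rw [e3, mem_fixK, map_add, map_mul, hβ, hσK, hσK]
    constructor
    · intro h; rw [h]; simp
    · intro h
      have : (2 * β) * (T : F) = 0 := by linear_combination -h
      have := (mul_eq_zero.mp this).resolve_left (mul_ne_zero h2 hβ0)
      exact_mod_cast this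
  by_cases hc2 : c2 = 0
  · skip
    have e : Nat.card {p : (Fin n → fixK σ) × (Fin n → fixK σ) //
        k * ∑ i, p.2 i ^ 2 - ∑ i, c1 i * p.2 i - ∑ i, c2 i * p.1 i + d2 = 0}
        = q ^ n * Nat.card {w : Fin n → fixK σ // k * ∑ i, w i ^ 2 - ∑ i, c1 i * w i + d2 = 0} := by
      have : q ^ n = Nat.card (Fin n → fixK σ) := by
        rw [Nat.card_eq_fintype_card, Fintype.card_fun, hK, Fintype.card_fin]
      rw [this, ← Nat.card_prod]
      simp only [hc2, Pi.zero_apply, zero_mul, sum_const_zero, sub_zero]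
      refine Nat.card_congr ⟨fun y => (y.1.1, ⟨y.1.2, y.2⟩), fun y => ⟨(y.1, y.2.1), y.2.2⟩,
        fun _ => rfl, fun _ => rfl⟩
    rw [hNX, e]
    subst hn
    have hcq := count_quad (K := fixK σ) (by rw [hK]; exact hq) m hm k d2 hk0 c1
    simp only [hK] at hcq
    rw [Nat.card_eq_fintype_card]
    have i1 : q ^ (2 * (2 * m) - 1) = q ^ (2 * m) * q ^ (2 * m - 1) := by
      rw [← pow_add]; congr 1; omega
    have i2 : q ^ (3 * m - 1) = q ^ (2 * m) * q ^ (m - 1) := by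
      rw [← pow_add]; congr 1; omega
    have i3 : q ^ (3 * m) = q ^ (2 * m) * q ^ m := by
      rw [← pow_add]; congr 1; omega
    rw [i1, i2, i3, ← mul_add, ← mul_add]
    rcases hcq with h | h
    · left; rw [← h]
    · right; right; rw [h]
  · right; left
    rw [hNX]
    have e : Nat.card {p : (Fin n → fixK σ) × (Fin n → fixK σ) //
        k * ∑ i, p.2 i ^ 2 - ∑ i, c1 i * p.2 i - ∑ i, c2 i * p.1 i + d2 = 0}
        = Nat.card (Σ w : Fin n → fixK σ, {v : Fin n → fixK σ //
          ∑ i, c2 i * v i = k * ∑ i, w i ^ 2 - ∑ i, c1 i * w i + d2}) := by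
      refine Nat.card_congr ⟨fun y => ⟨y.1.2, y.1.1, by linear_combination -y.2⟩,
        fun y => ⟨(y.2.1, y.1), by linear_combination -y.2.2⟩, fun _ => rfl, fun _ => rfl⟩
    rw [e, Nat.card_eq_fintype_card, Fintype.card_sigma]
    simp only [card_hyper n c2 hc2, hK]
    rw [sum_const, card_univ, Fintype.card_fun, hK, Fintype.card_fin, smul_eq_mul, ← pow_add]; congr 1; omega
end core

theorem statement4 (q r : ℕ) (hq : IsPrimePow q) (hqmod : q % 4 = 3)
    (hr : 3 ≤ r) (hrmod : r % 4 = 3)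
    {F : Type*} [Field F] [Fintype F] (hF : Fintype.card F = q ^ 2)
    (a b : F) (ha : a ≠ 0) (hb : b ^ q ≠ b)
    (hab : 4 * a ^ (q + 1) + (b ^ q - b) ^ 2 = 0) :
    (BSet q r a b).ncard = q ^ (2 * r - 1) ∧
    ∀ (c : Fin (r - 1) → F) (c0 d : F), ¬(c = 0 ∧ c0 = 0) →
      (({x : (Fin (r - 1) → F) × F | (∑ i, c i * x.1 i) + c0 * x.2 = d}
          ∩ BSet q r a b)).ncard ∈
        ({q ^ (2 * r - 3) + q ^ ((3 * r - 5) / 2) - q ^ (3 * (r - 1) / 2),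
          q ^ (2 * r - 3),
          q ^ (2 * r - 3) + q ^ ((3 * r - 5) / 2)} : Set ℕ) := by
  obtain ⟨σ, hσq⟩ : ∃ σ : F →+* F, ∀ x, σ x = x ^ q := by
    obtain ⟨p, k, hp, hk, rfl⟩ := (isPrimePow_nat_iff _).1 hq
    have : Fact p.Prime := ⟨hp⟩
    have : CharP F p := by
      obtain ⟨p', hp'⟩ := CharP.exists F
      obtain ⟨n, hn, hc⟩ := FiniteField.card F p'
      have h1 : p ∣ p' ^ (n : ℕ) := by
        rw [← hc, hF]; exact dvd_pow (dvd_pow_self p hk.ne') two_ne_zero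
      have := (Nat.prime_dvd_prime_iff_eq hp hn).1 (hp.dvd_of_dvd_pow h1)
      rwa [this]
    exact ⟨iterateFrobenius F p k, fun x => iterateFrobenius_def ..⟩
  have hσ : ∀ x, σ (σ x) = x := by
    intro x; rw [hσq, hσq, ← pow_mul, ← sq, ← hF]; exact FiniteField.pow_card x
  have h2 : (2 : F) ≠ 0 := by
    apply Ring.two_ne_zero
    intro h
    have := FiniteField.even_card_of_char_two h
    rw [hF, Nat.pow_mod] at this
    have h3 : q % 2 = 1 := by omega
    rw [h3] at this; omega
  set β := b ^ q - b with hβdef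
  have hβ0 : β ≠ 0 := sub_ne_zero.mpr hb
  have hβ : σ β = -β := by rw [hβdef, ← hσq, map_sub, hσ]; ring
  have hσa : σ a ≠ 0 := by simpa using ha
  have hab' : 4 * (σ a * a) + β ^ 2 = 0 := by
    rw [hσq, ← pow_succ]; exact hab
  obtain ⟨s, hs, hst⟩ : ∃ s : F, s ≠ 0 ∧ 2 * σ a * σ s = β * s := by
    by_cases h : β - 2 * σ a = 0
    · refine ⟨2, h2, ?_⟩
      rw [map_ofNat]; linear_combination -2 * h
    · refine ⟨β - 2 * σ a, h, ?_⟩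
      simp only [map_sub, map_mul, map_ofNat, hβ, hσ]
      linear_combination -hab'
  have r1 : σ a * σ s ^ 2 = - (a * s ^ 2) := by
    apply mul_left_cancel₀ (mul_ne_zero (mul_ne_zero h2 h2) hσa)
    linear_combination (2 * σ a * σ s + β * s) * hst + s ^ 2 * hab'
  have r2 : β * s * σ s = 2 * (σ a * σ s ^ 2) := by linear_combination -σ s * hst
  obtain ⟨j, rfl⟩ : ∃ j, r = 4 * j + 3 := ⟨r / 4, by omega⟩
  have hcore := core q (4 * j + 3 - 1) (2 * j + 1) hqmod (by omega) (by omega) hF σ hσ h2 β hβ0 hβ a s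
    ha hs r1 r2 (BSet q (4 * j + 3) a b) (by
      intro x
      simp only [BSet, Set.mem_ofPred_eq, hσq]
      have e1 : ∀ i, x.1 i ^ (2 * q) = (x.1 i ^ q) ^ 2 := fun i => by
        rw [← pow_mul]; exact congrArg _ (mul_comm _ _)
      have e2 : ∀ i, x.1 i ^ (q + 1) = x.1 i * x.1 i ^ q := fun i => pow_succ' _ _
      simp only [e1, e2, hβdef])
  refine ⟨by rw [hcore.1]; congr 1, ?_⟩
  intro c c0 d hc
  have h := hcore.2 c c0 d hc
  have i1 : 2 * (4 * j + 3) - 3 = 2 * (4 * j + 3 - 1) - 1 := by omega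
  have i2 : (3 * (4 * j + 3) - 5) / 2 = 3 * (2 * j + 1) - 1 := by omega
  have i3 : 3 * (4 * j + 3 - 1) / 2 = 3 * (2 * j + 1) := by omega
  rw [i1, i2, i3]
  simp only [Set.mem_insert_iff, Set.mem_singleton_iff]
  rcases h with h | h | h
  · left; exact Nat.eq_sub_of_add_eq h
  · right; left; exact h
  · right; right; exact h
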